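/- arXiv:2603.17691 — 4 statements merged into one kernel-verified Lean document; each statement's English description precedes it below -/
import Mathlib

section
/- Let X ⊆ ℝ^n, let F_lb, F_ub : ℝ^n → ℝ² satisfy F_lb(x) ≤ F_ub(x) componentwise for all x ∈ X, let K = ℝ²_+, and define the rectangle-valued mapping S(x) = [F_lb(x), F_ub(x)] ⊆ ℝ². Then x̄ ∈ X is a strictly minimal solution of the rectangle-valued optimization problem min_{x∈X} S(x) with respect to the set-less relation ⪯_K if and only if x̄ is a strictly efficient solution of minimizing the vector function G(x) = (F_ub(x), F_lb(x)) ∈ ℝ⁴ with respect to the cone ℝ⁴_+. -/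
/-- `a ≤_K b` iff `b - a ∈ K`. -/
def leK {α : Type*} [AddCommGroup α] (K : Set α) (a b : α) : Prop := b - a ∈ K

/-- Lower set-less relation. -/
def lowerSetLess {α : Type*} [AddCommGroup α] (K A B : Set α) : Prop :=
  ∀ b ∈ B, ∃ a ∈ A, leK K a b

/-- Upper set-less relation. -/
def upperSetLess {α : Type*} [AddCommGroup α] (K A B : Set α) : Prop :=
  ∀ a ∈ A, ∃ b ∈ B, leK K a b

/-- Set-less relation: both lower and upper set-less. -/
def setLess {α : Type*} [AddCommGroup α] (K A B : Set α) : Prop :=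
  lowerSetLess K A B ∧ upperSetLess K A B

/-- The non-negative orthant `ℝ^k_+`. -/
def posOrthant (k : ℕ) : Set (Fin k → ℝ) := {y | 0 ≤ y}

/-- `x*` is a strictly minimal solution (set approach) of `min_{x ∈ X} S(x)` w.r.t. `⪯_K`. -/
def StrictlyMinimalSolution {β : Type*} {α : Type*} [AddCommGroup α]
    (X : Set β) (S : β → Set α) (K : Set α) (xstar : β) : Prop :=
  xstar ∈ X ∧ ∀ x ∈ X, setLess K (S x) (S xstar) → setLess K (S xstar) (S x)

/-- `x*` is a strictly efficient solution of minimizing `G` over `X` w.r.t. the componentwise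
order. -/
def StrictlyEfficient {β : Type*} {γ : Type*} [PartialOrder γ]
    (X : Set β) (G : β → γ) (xstar : β) : Prop :=
  xstar ∈ X ∧ ∀ x ∈ X, G x ≤ G xstar → G x = G xstar

theorem setLess_Icc_iff {a b c d : Fin 2 → ℝ} (hab : a ≤ b) (hcd : c ≤ d) :
    setLess (posOrthant 2) (Set.Icc a b) (Set.Icc c d) ↔ a ≤ c ∧ b ≤ d := by
  simp only [setLess, lowerSetLess, upperSetLess, leK, posOrthant, Set.mem_setOf_eq, sub_nonneg]
  constructor
  · rintro ⟨h1, h2⟩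
    obtain ⟨y, hy, hyc⟩ := h1 c ⟨le_refl _, hcd⟩
    obtain ⟨z, hz, hbz⟩ := h2 b ⟨hab, le_refl _⟩
    exact ⟨hy.1.trans hyc, hbz.trans hz.2⟩
  · rintro ⟨h1, h2⟩
    exact ⟨fun y hy => ⟨a, ⟨le_refl _, hab⟩, h1.trans hy.1⟩,
      fun y hy => ⟨d, ⟨hcd, le_refl _⟩, hy.2.trans h2⟩⟩

/-- Vectorization for rectangle-valued optimization: with rectangles
`S(x) = [F_lb(x), F_ub(x)] ⊆ ℝ²` and `K = ℝ²_+`, `x̄` is a strictly minimal solution of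
`min_{x∈X} S(x)` w.r.t. `⪯_K` iff `x̄` is a strictly efficient solution of minimizing
`G(x) = (F_ub(x), F_lb(x)) ∈ ℝ⁴` w.r.t. `ℝ⁴_+`. -/
theorem rvo_vectorization {n : ℕ} (X : Set (Fin n → ℝ))
    (Flb Fub : (Fin n → ℝ) → (Fin 2 → ℝ))
    (hle : ∀ x ∈ X, Flb x ≤ Fub x) (xbar : Fin n → ℝ) :
    StrictlyMinimalSolution X (fun x => Set.Icc (Flb x) (Fub x)) (posOrthant 2) xbar ↔
    StrictlyEfficient X (fun x => (Fub x, Flb x)) xbar := by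
  unfold StrictlyMinimalSolution StrictlyEfficient
  refine and_congr_right fun hb => forall₂_congr fun x hx => ?_
  simp only [setLess_Icc_iff (hle x hx) (hle xbar hb), setLess_Icc_iff (hle xbar hb) (hle x hx),
    Prod.mk_le_mk, Prod.mk.injEq]
  constructor
  · rintro h ⟨h1, h2⟩
    obtain ⟨h3, h4⟩ := h ⟨h2, h1⟩
    exact ⟨le_antisymm h1 h4, le_antisymm h2 h3⟩
  · rintro h ⟨h1, h2⟩
    obtain ⟨h3, h4⟩ := h ⟨h2, h1⟩
    exact ⟨h4.ge, h3.ge⟩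
end

section
/- Let Z be an integrable real-valued random variable and let p ∈ (0,1). Then the subquantile of Z at level p equals the negative of the superquantile of −Z at level 1−p, i.e., (1/p) ∫_0^p Q_Z(u) du = −(1/p) ∫_{1−p}^1 Q_{−Z}(v) dv, where Q_{−Z} is the quantile function of −Z. -/
open MeasureTheory

/-- The cumulative distribution function `F_Z(t) = P(Z ≤ t)` of a random variable `Z`. -/
noncomputable def cdfRV {Ω : Type*} [MeasurableSpace Ω] (μ : Measure Ω) (Z : Ω → ℝ) (t : ℝ) : ℝ :=
  (μ {ω | Z ω ≤ t}).toReal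

/-- The quantile function `Q_Z(u) = inf {t : F_Z(t) ≥ u}` of a random variable `Z`. -/
noncomputable def quantileRV {Ω : Type*} [MeasurableSpace Ω] (μ : Measure Ω) (Z : Ω → ℝ)
    (u : ℝ) : ℝ :=
  sInf {t : ℝ | u ≤ cdfRV μ Z t}

theorem aux_cdf {Ω : Type*} [MeasurableSpace Ω] (μ : Measure Ω)
    [IsProbabilityMeasure μ] (Z : Ω → ℝ) (hZ : Measurable Z) (t : ℝ) :
    cdfRV μ Z t = ProbabilityTheory.cdf (μ.map Z) t := by
  have : IsProbabilityMeasure (μ.map Z) := Measure.isProbabilityMeasure_map hZ.aemeasurable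
  rw [ProbabilityTheory.cdf_eq_real, measureReal_def, Measure.map_apply hZ measurableSet_Iic]
  rfl

theorem aux_ne {Ω : Type*} [MeasurableSpace Ω] (μ : Measure Ω)
    [IsProbabilityMeasure μ] (Z : Ω → ℝ) (hZ : Measurable Z) (u : ℝ) (hu : u < 1) :
    {t : ℝ | u ≤ cdfRV μ Z t}.Nonempty := by
  have h := (ProbabilityTheory.tendsto_cdf_atTop (μ.map Z)).eventually (lt_mem_nhds hu)
  obtain ⟨t, ht⟩ := h.exists
  exact ⟨t, by simpa [aux_cdf μ Z hZ] using ht.le⟩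

theorem aux_mono {Ω : Type*} [MeasurableSpace Ω] (μ : Measure Ω)
    [IsProbabilityMeasure μ] (Z : Ω → ℝ) : Monotone (cdfRV μ Z) := by
  intro s t hst
  exact measureReal_mono (μ := μ) (fun ω (h : Z ω ≤ s) => h.trans hst)

theorem aux_bdd {Ω : Type*} [MeasurableSpace Ω] (μ : Measure Ω)
    [IsProbabilityMeasure μ] (Z : Ω → ℝ) (hZ : Measurable Z) (u : ℝ) (hu : 0 < u) :
    BddBelow {t : ℝ | u ≤ cdfRV μ Z t} := by
  have h := (ProbabilityTheory.tendsto_cdf_atBot (μ.map Z)).eventually (gt_mem_nhds hu)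
  obtain ⟨t, ht⟩ := h.exists
  rw [← aux_cdf μ Z hZ] at ht
  refine ⟨t, fun s hs => ?_⟩
  by_contra! hc
  have := aux_mono μ Z hc.le
  have hs' : u ≤ cdfRV μ Z s := hs
  linarith

/-- `F_Z(s) + F_{-Z}(-s) ≥ 1`. -/
theorem aux_ge {Ω : Type*} [MeasurableSpace Ω] (μ : Measure Ω)
    [IsProbabilityMeasure μ] (Z : Ω → ℝ) (s : ℝ) :
    1 ≤ cdfRV μ Z s + cdfRV μ (fun ω => -Z ω) (-s) := by
  have h := measureReal_union_le (μ := μ) {ω | Z ω ≤ s} {ω | -Z ω ≤ -s}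
  have h2 : {ω | Z ω ≤ s} ∪ {ω | -Z ω ≤ -s} = Set.univ := by
    ext ω
    simpa using le_total (Z ω) s
  rw [h2, probReal_univ] at h
  exact h

theorem aux_le {Ω : Type*} [MeasurableSpace Ω] (μ : Measure Ω)
    [IsProbabilityMeasure μ] (Z : Ω → ℝ) (hZ : Measurable Z) (s t : ℝ) (hst : s < t) :
    cdfRV μ Z s + cdfRV μ (fun ω => -Z ω) (-t) ≤ 1 := by
  have hd : Disjoint {ω | Z ω ≤ s} {ω | -Z ω ≤ -t} := by
    rw [Set.disjoint_left]
    intro ω (h1 : Z ω ≤ s) (h2 : -Z ω ≤ -t)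
    linarith
  have h := measureReal_union (μ := μ) hd (measurableSet_le hZ.neg measurable_const)
  have h2 : μ.real ({ω | Z ω ≤ s} ∪ {ω | -Z ω ≤ -t}) ≤ 1 := measureReal_le_one
  rw [h] at h2
  exact h2

theorem aux_lower {Ω : Type*} [MeasurableSpace Ω] (μ : Measure Ω)
    [IsProbabilityMeasure μ] (Z : Ω → ℝ) (hZ : Measurable Z) (u : ℝ)
    (hu : u ∈ Set.Ioo (0 : ℝ) 1) :
    quantileRV μ Z u ≤ -quantileRV μ (fun ω => -Z ω) (1 - u) := by
  by_contra! hc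
  obtain ⟨s, h1, h2⟩ := exists_between hc
  obtain ⟨s', h3, h4⟩ := exists_between h2
  have k1 : cdfRV μ Z s < u := by
    by_contra! hh
    exact absurd (csInf_le (aux_bdd μ Z hZ u hu.1) hh) (not_le.mpr h2)
  have k2 : cdfRV μ (fun ω => -Z ω) (-s) < 1 - u := by
    by_contra! hh
    have : quantileRV μ (fun ω => -Z ω) (1 - u) ≤ -s :=
      csInf_le (aux_bdd μ _ hZ.neg (1 - u) (by linarith [hu.2])) hh
    linarith
  linarith [aux_ge μ Z s]

theorem aux_upper {Ω : Type*} [MeasurableSpace Ω] (μ : Measure Ω)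
    [IsProbabilityMeasure μ] (Z : Ω → ℝ) (hZ : Measurable Z) (u u' : ℝ)
    (hu : u ∈ Set.Ioo (0 : ℝ) 1) (hu' : u' ∈ Set.Ioo (0 : ℝ) 1) (h : u < u') :
    -quantileRV μ (fun ω => -Z ω) (1 - u) ≤ quantileRV μ Z u' := by
  by_contra! hc
  obtain ⟨s, h1, h2⟩ := exists_between hc
  obtain ⟨a, ha, has⟩ := exists_lt_of_csInf_lt (aux_ne μ Z hZ u' hu'.2) h1
  have h2' : quantileRV μ (fun ω => -Z ω) (1 - u) < -s := by linarith
  obtain ⟨b, hb, hbs⟩ := exists_lt_of_csInf_lt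
    (aux_ne μ _ hZ.neg (1 - u) (by linarith [hu.1])) h2'
  have ha' : u' ≤ cdfRV μ Z a := ha
  have hb' : 1 - u ≤ cdfRV μ (fun ω => -Z ω) b := hb
  have := aux_le μ Z hZ a (-b) (by linarith)
  rw [neg_neg] at this
  linarith

theorem aux_qmono {Ω : Type*} [MeasurableSpace Ω] (μ : Measure Ω)
    [IsProbabilityMeasure μ] (Z : Ω → ℝ) (hZ : Measurable Z) :
    MonotoneOn (quantileRV μ Z) (Set.Ioo (0 : ℝ) 1) := by
  intro u hu v hv huv
  exact csInf_le_csInf (aux_bdd μ Z hZ u hu.1) (aux_ne μ Z hZ v hv.2)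
    (fun t (ht : v ≤ _) => huv.trans ht)

theorem aux_ae {Ω : Type*} [MeasurableSpace Ω] (μ : Measure Ω)
    [IsProbabilityMeasure μ] (Z : Ω → ℝ) (hZ : Measurable Z) :
    ∀ᵐ u : ℝ, u ∈ Set.Ioo (0 : ℝ) 1 →
      quantileRV μ Z u = -quantileRV μ (fun ω => -Z ω) (1 - u) := by
  have hc := (aux_qmono μ Z hZ).countable_not_continuousWithinAt
  filter_upwards [hc.ae_notMem volume] with u hu hu1
  have hcont : ContinuousWithinAt (quantileRV μ Z) (Set.Ioo 0 1) u := by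
    by_contra hh
    exact hu ⟨hu1, hh⟩
  refine le_antisymm (aux_lower μ Z hZ u hu1) ?_
  have hcont' := hcont.continuousAt (Ioo_mem_nhds hu1.1 hu1.2)
  have ht : Filter.Tendsto (quantileRV μ Z) (nhdsWithin u (Set.Ioi u))
      (nhds (quantileRV μ Z u)) := hcont'.tendsto.mono_left nhdsWithin_le_nhds
  refine ge_of_tendsto ht ?_
  filter_upwards [Ioo_mem_nhdsGT hu1.2] with v hv
  exact aux_upper μ Z hZ u v hu1 ⟨hu1.1.trans hv.1, hv.2⟩ hv.1

/-- The subquantile of `Z` at level `p` equals the negative of the superquantile of `−Z` at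
level `1−p`: `(1/p) ∫_0^p Q_Z(u) du = −(1/p) ∫_{1−p}^1 Q_{−Z}(v) dv`. -/
theorem subquantile_eq_neg_superquantile {Ω : Type*} [MeasurableSpace Ω] (μ : Measure Ω)
    [IsProbabilityMeasure μ] (Z : Ω → ℝ) (hZ : Measurable Z) (hZint : Integrable Z μ)
    (p : ℝ) (hp : p ∈ Set.Ioo (0 : ℝ) 1) :
    (1 / p) * ∫ u in (0 : ℝ)..p, quantileRV μ Z u =
      -((1 / p) * ∫ v in (1 - p)..(1 : ℝ), quantileRV μ (fun ω => -Z ω) v) := by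
  have h1 : ∫ v in (1 - p)..(1 : ℝ), quantileRV μ (fun ω => -Z ω) v =
      ∫ u in (0 : ℝ)..p, quantileRV μ (fun ω => -Z ω) (1 - u) := by
    rw [intervalIntegral.integral_comp_sub_left (fun v => quantileRV μ (fun ω => -Z ω) v) 1,
      sub_zero]
  rw [h1, ← mul_neg, ← intervalIntegral.integral_neg]
  congr 1
  apply intervalIntegral.integral_congr_ae
  filter_upwards [aux_ae μ Z hZ] with u hu hup
  rw [Set.uIoc_of_le hp.1.le] at hup
  exact hu ⟨hup.1, hup.2.trans_lt hp.2⟩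
end

section
/- Let K ⊆ ℝ^m be a closed, convex, pointed cone with dual cone K*, and let 𝓕 be a family of nonempty compact subsets of ℝ^m such that for every C ∈ 𝓕 the sets C + K and C − K are closed and convex. Then A ∈ 𝓕 is a strictly minimal element of 𝓕 w.r.t. the set-less relation ⪯_K if and only if there is no B ∈ 𝓕 such that: for all ℓ ∈ K* \ {0}, sup_{b∈B} ℓᵀb ≤ sup_{a∈A} ℓᵀa and inf_{b∈B} ℓᵀb ≤ inf_{a∈A} ℓᵀa; and for some ℓ ∈ K* \ {0}, sup_{b∈B} ℓᵀb < sup_{a∈A} ℓᵀa or inf_{b∈B} ℓᵀb < inf_{a∈A} ℓᵀa. -/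
open Set Pointwise

/-- The Euclidean inner product `ℓᵀa` on `ℝ^m`. -/
def dot {m : ℕ} (ℓ a : Fin m → ℝ) : ℝ := ∑ i, ℓ i * a i

/-- The dual cone `K* = {ℓ : ℓᵀy ≥ 0 for all y ∈ K}`. -/
def dualCone {m : ℕ} (K : Set (Fin m → ℝ)) : Set (Fin m → ℝ) :=
  {ℓ | ∀ y ∈ K, 0 ≤ dot ℓ y}

/-- `K` is a cone: closed under multiplication by non-negative scalars. -/
def IsConeSet {m : ℕ} (K : Set (Fin m → ℝ)) : Prop :=
  ∀ c : ℝ, 0 ≤ c → ∀ x ∈ K, c • x ∈ K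

/-- `K` is pointed: `K ∩ (−K) = {0}`. -/
def IsPointed {m : ℕ} (K : Set (Fin m → ℝ)) : Prop := K ∩ (-K) = {0}

/-- `A` is a strictly minimal element of the family `𝓕` w.r.t. `⪯_K`:
every `B ∈ 𝓕` with `B ⪯_K A` satisfies `A ⪯_K B`. -/
def StrictlyMinimalElement {α : Type*} [AddCommGroup α]
    (F : Set (Set α)) (K : Set α) (A : Set α) : Prop :=
  ∀ B ∈ F, setLess K B A → setLess K A B

theorem dot_cont {m : ℕ} (ℓ : Fin m → ℝ) : Continuous (dot ℓ) := by
  unfold dot; fun_prop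

theorem dot_sub' {m : ℕ} (ℓ a b : Fin m → ℝ) : dot ℓ (a - b) = dot ℓ a - dot ℓ b := by
  simp [dot, mul_sub, Finset.sum_sub_distrib]

theorem dot_neg' {m : ℕ} (ℓ a : Fin m → ℝ) : dot ℓ (-a) = - dot ℓ a := by
  simp [dot]

theorem lower_iff {m : ℕ} (K A B : Set (Fin m → ℝ)) (hKcone : IsConeSet K) (h0 : (0 : Fin m → ℝ) ∈ K)
    (hAn : A.Nonempty) (hAc : IsCompact A) (hcl : IsClosed (A + K)) (hcv : Convex ℝ (A + K))
    (hBn : B.Nonempty) (hBc : IsCompact B) :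
    lowerSetLess K A B ↔ ∀ ℓ ∈ dualCone K \ {0}, sInf (dot ℓ '' A) ≤ sInf (dot ℓ '' B) := by
  have bdd : ∀ (C : Set (Fin m → ℝ)) ℓ, IsCompact C → BddBelow (dot ℓ '' C) := fun C ℓ hC =>
    (hC.image (dot_cont ℓ)).bddBelow
  constructor
  · intro h ℓ hℓ
    apply le_csInf (hBn.image _)
    rintro _ ⟨b, hb, rfl⟩
    obtain ⟨a, ha, hab⟩ := h b hb
    have h1 := hℓ.1 _ hab
    rw [dot_sub'] at h1
    have h2 := csInf_le (bdd A ℓ hAc) (mem_image_of_mem _ ha)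
    linarith
  · intro h b hb
    by_contra hcon
    have hb' : b ∉ A + K := by
      rintro ⟨a, ha, k, hk, rfl⟩
      exact hcon ⟨a, ha, by simpa [leK] using hk⟩
    obtain ⟨f, u, hfb, hfu⟩ := geometric_hahn_banach_point_closed hcv hcl hb'
    have hdot : ∀ y, dot (fun i => f (Pi.single i 1)) y = f y := by
      intro y
      have := LinearMap.pi_apply_eq_sum_univ (f : (Fin m → ℝ) →ₗ[ℝ] ℝ) y
      simp only [ContinuousLinearMap.coe_coe, smul_eq_mul] at this
      rw [this]
      unfold dot
      refine Finset.sum_congr rfl fun i _ => ?_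
      rw [mul_comm]
      refine congrArg (fun t => y i * f t) ?_
      ext j
      simp [Pi.single_apply, eq_comm]
    have hfA : ∀ a ∈ A, u < f a := fun a ha => hfu a ⟨a, ha, 0, h0, by simp⟩
    obtain ⟨a, ha⟩ := hAn
    have hm : (fun i => f (Pi.single i 1)) ∈ dualCone K \ {0} := by
      constructor
      · intro y hy
        rw [hdot]
        by_contra hneg
        push Not at hneg
        have h1 := hfA a ha
        have hc : 0 ≤ (f a - f b) / (- f y) := div_nonneg (by linarith) (by linarith)
        have h2 := hfu _ ⟨a, ha, _, hKcone _ hc y hy, rfl⟩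
        simp only [map_add, map_smul, smul_eq_mul] at h2
        have h3 : (f a - f b) / (- f y) * f y = f b - f a := by
          have := hneg.ne
          field_simp
          ring
        linarith
      · intro hz
        have hz' : (fun i => f (Pi.single i 1)) = 0 := hz
        have e1 := hdot a
        have e2 := hdot b
        rw [hz'] at e1 e2
        simp [dot] at e1 e2
        have := hfA a ha
        linarith
    have h1 := h _ hm
    have h2 := csInf_le (bdd B (fun i => f (Pi.single i 1)) hBc) (mem_image_of_mem _ hb)
    have h3 : u ≤ sInf (dot (fun i => f (Pi.single i 1)) '' A) := by
      apply le_csInf (Set.Nonempty.image _ ⟨a, ha⟩)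
      rintro _ ⟨c, hc, rfl⟩
      rw [hdot]
      exact (hfA c hc).le
    rw [hdot] at h2
    linarith

theorem sInf_dot_neg {m : ℕ} (ℓ : Fin m → ℝ) (C : Set (Fin m → ℝ)) :
    sInf (dot ℓ '' (-C)) = - sSup (dot ℓ '' C) := by
  rw [Real.sInf_def]
  congr 2
  ext x
  constructor
  · rintro ⟨c, hc, h⟩
    exact ⟨-c, hc, by rw [dot_neg', h, neg_neg]⟩
  · rintro ⟨c, hc, rfl⟩
    exact ⟨-c, by simpa using hc, dot_neg' _ _⟩

theorem upper_iff {m : ℕ} (K A B : Set (Fin m → ℝ)) (hKcone : IsConeSet K) (h0 : (0 : Fin m → ℝ) ∈ K)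
    (hAn : A.Nonempty) (hAc : IsCompact A) (hcl : IsClosed (B - K)) (hcv : Convex ℝ (B - K))
    (hBn : B.Nonempty) (hBc : IsCompact B) :
    upperSetLess K A B ↔ ∀ ℓ ∈ dualCone K \ {0}, sSup (dot ℓ '' A) ≤ sSup (dot ℓ '' B) := by
  have e : -B + K = -(B - K) := by rw [neg_sub', sub_neg_eq_add]
  have h := lower_iff K (-B) (-A) hKcone h0 hBn.neg hBc.neg (by rw [e]; exact hcl.neg)
    (by rw [e]; exact hcv.neg) hAn.neg hAc.neg
  simp only [sInf_dot_neg, neg_le_neg_iff] at h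
  rw [← h]
  constructor
  · intro H a ha
    obtain ⟨b, hb, hab⟩ := H (-a) ha
    refine ⟨-b, by simpa using hb, ?_⟩
    have e2 : a - -b = b - -a := by abel
    unfold leK at *
    rwa [e2]
  · intro H a ha
    obtain ⟨b, hb, hab⟩ := H (-a) (by simpa using ha)
    refine ⟨-b, hb, ?_⟩
    have e2 : -b - a = -a - b := by abel
    unfold leK at *
    rwa [e2]

/-- Characterization of strictly minimal elements of a family of sets via the dual cone:
`A ∈ 𝓕` is strictly minimal w.r.t. `⪯_K` iff there is no `B ∈ 𝓕` such that
(for all `ℓ ∈ K* \ {0}`, `sup_B ℓᵀb ≤ sup_A ℓᵀa` and `inf_B ℓᵀb ≤ inf_A ℓᵀa`) and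
(for some `ℓ ∈ K* \ {0}`, `sup_B ℓᵀb < sup_A ℓᵀa` or `inf_B ℓᵀb < inf_A ℓᵀa`). -/
theorem strictlyMinimal_iff_no_dominating {m : ℕ} (K : Set (Fin m → ℝ))
    (F : Set (Set (Fin m → ℝ)))
    (hKclosed : IsClosed K) (hKconvex : Convex ℝ K) (hKcone : IsConeSet K)
    (hKpointed : IsPointed K)
    (hF : ∀ C ∈ F, C.Nonempty ∧ IsCompact C ∧
      IsClosed (C + K) ∧ Convex ℝ (C + K) ∧ IsClosed (C - K) ∧ Convex ℝ (C - K))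
    (A : Set (Fin m → ℝ)) (hA : A ∈ F) :
    StrictlyMinimalElement F K A ↔
      ¬ ∃ B ∈ F,
        (∀ ℓ ∈ dualCone K \ {0},
          sSup (dot ℓ '' B) ≤ sSup (dot ℓ '' A) ∧ sInf (dot ℓ '' B) ≤ sInf (dot ℓ '' A)) ∧
        (∃ ℓ ∈ dualCone K \ {0},
          sSup (dot ℓ '' B) < sSup (dot ℓ '' A) ∨ sInf (dot ℓ '' B) < sInf (dot ℓ '' A)) := by
  have h0 : (0 : Fin m → ℝ) ∈ K := by
    have : (0 : Fin m → ℝ) ∈ K ∩ (-K) := by rw [hKpointed]; rfl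
    exact this.1
  have key : ∀ C ∈ F, ∀ D ∈ F, (setLess K C D ↔ ∀ ℓ ∈ dualCone K \ {0},
      sSup (dot ℓ '' C) ≤ sSup (dot ℓ '' D) ∧ sInf (dot ℓ '' C) ≤ sInf (dot ℓ '' D)) := by
    intro C hC D hD
    obtain ⟨c1, c2, c3, c4, c5, c6⟩ := hF C hC
    obtain ⟨d1, d2, d3, d4, d5, d6⟩ := hF D hD
    unfold setLess
    rw [lower_iff K C D hKcone h0 c1 c2 c3 c4 d1 d2, upper_iff K C D hKcone h0 c1 c2 d5 d6 d1 d2]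
    exact ⟨fun h ℓ hℓ => ⟨h.2 ℓ hℓ, h.1 ℓ hℓ⟩,
      fun h => ⟨fun ℓ hℓ => (h ℓ hℓ).2, fun ℓ hℓ => (h ℓ hℓ).1⟩⟩
  constructor
  · rintro h ⟨B, hB, h1, ℓ, hℓ, h2⟩
    have h3 := (key A hA B hB).1 (h B hB ((key B hB A hA).2 h1)) ℓ hℓ
    rcases h2 with h2 | h2
    · exact absurd h3.1 (not_le.2 h2)
    · exact absurd h3.2 (not_le.2 h2)
  · intro h B hB hBA
    rw [key A hA B hB]
    intro ℓ hℓ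
    by_contra hcon
    refine h ⟨B, hB, (key B hB A hA).1 hBA, ℓ, hℓ, ?_⟩
    rw [not_and_or, not_le, not_le] at hcon
    exact hcon
end

section
/- Let K ⊆ ℝ^m be a closed, convex, pointed cone with dual cone K*, let X be a feasible set, and let S be a set-valued mapping on X such that for every x ∈ X the image S(x) ⊆ ℝ^m is nonempty and compact and the sets S(x) + K and S(x) − K are closed and convex. Then x̄ ∈ X is a strictly minimal solution of the set-valued problem min_{x∈X} S(x) w.r.t. the set-less relation ⪯_K if and only if for every x ∈ X the following holds: if for all ℓ ∈ K* \ {0} one has sup_{a∈S(x)} ℓᵀa ≤ sup_{a∈S(x̄)} ℓᵀa and inf_{a∈S(x)} ℓᵀa ≤ inf_{a∈S(x̄)} ℓᵀa, then for all ℓ ∈ K* \ {0} one also has sup_{a∈S(x̄)} ℓᵀa ≤ sup_{a∈S(x)} ℓᵀa and inf_{a∈S(x̄)} ℓᵀa ≤ inf_{a∈S(x)} ℓᵀa. -/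
open Set Pointwise

lemma dot_add_aux {m : ℕ} (l a b : Fin m → ℝ) : dot l (a + b) = dot l a + dot l b := by
  simp [dot, mul_add, Finset.sum_add_distrib]

lemma dot_sub_aux {m : ℕ} (l a b : Fin m → ℝ) : dot l (a - b) = dot l a - dot l b := by
  simp [dot, mul_sub, Finset.sum_sub_distrib]

lemma dot_neg_aux {m : ℕ} (l a : Fin m → ℝ) : dot l (-a) = - dot l a := by
  simp [dot]

lemma dot_cont_aux {m : ℕ} (l : Fin m → ℝ) : Continuous (dot l) := by
  unfold dot; fun_prop

lemma exists_dot_aux {m : ℕ} (f : (Fin m → ℝ) →L[ℝ] ℝ) : ∃ l : Fin m → ℝ, ∀ a, f a = dot l a := by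
  refine ⟨fun i => f (Pi.single i 1), fun a => ?_⟩
  conv_lhs => rw [pi_eq_sum_univ' a]
  simp only [map_sum, map_smul, smul_eq_mul, dot]
  refine Finset.sum_congr rfl fun i _ => ?_
  rw [mul_comm]

lemma lower_iff_aux {m : ℕ} {K A B : Set (Fin m → ℝ)} (hcone : IsConeSet K) (h0 : (0 : Fin m → ℝ) ∈ K)
    (hA : A.Nonempty) (hAc : IsCompact A) (hB : B.Nonempty) (hBc : IsCompact B)
    (hcl : IsClosed (A + K)) (hcv : Convex ℝ (A + K)) :
    lowerSetLess K A B ↔ ∀ l ∈ dualCone K \ {0}, sInf (dot l '' A) ≤ sInf (dot l '' B) := by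
  constructor
  · rintro h l ⟨hl, -⟩
    refine le_csInf (hB.image _) ?_
    rintro _ ⟨b, hb, rfl⟩
    obtain ⟨a, ha, hab⟩ := h b hb
    have h1 := hl _ hab
    rw [dot_sub_aux] at h1
    have h2 := csInf_le (hAc.image (dot_cont_aux l)).bddBelow (mem_image_of_mem _ ha)
    linarith
  · intro h b hb
    by_contra hcon
    have hb' : b ∉ A + K := by
      rintro ⟨a, ha, k, hk, rfl⟩
      exact hcon ⟨a, ha, by simpa [leK] using hk⟩
    obtain ⟨f, u, hfu, hu⟩ := geometric_hahn_banach_point_closed hcv hcl hb'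
    obtain ⟨l, hl⟩ := exists_dot_aux f
    obtain ⟨a₀, ha₀⟩ := hA
    have hdual : l ∈ dualCone K := by
      intro y hy
      by_contra! hneg
      rw [← hl] at hneg
      have hA0 := hu _ (add_mem_add ha₀ h0)
      rw [add_zero] at hA0
      have hc : 0 ≤ (f a₀ - u) / (- f y) := div_nonneg (by linarith) (by linarith)
      have := hu _ (add_mem_add ha₀ (hcone _ hc y hy))
      rw [map_add, map_smul, smul_eq_mul] at this
      have e : (f a₀ - u) / (- f y) * f y = -(f a₀ - u) := by
        have hy0 : f y ≠ 0 := hneg.ne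
        field_simp
      linarith
    have hne : l ≠ 0 := by
      rintro rfl
      have h1 := hu _ (add_mem_add ha₀ h0)
      rw [hl] at h1 hfu
      simp [dot] at h1 hfu
      linarith
    have h1 := h l ⟨hdual, hne⟩
    have h2 := csInf_le (hBc.image (dot_cont_aux l)).bddBelow (mem_image_of_mem _ hb)
    have h3 : u ≤ sInf (dot l '' A) := by
      refine le_csInf (⟨a₀, ha₀⟩ |> fun h : A.Nonempty => h.image _) ?_
      rintro _ ⟨a, ha, rfl⟩
      have := hu _ (add_mem_add ha h0)
      rw [add_zero, hl] at this
      exact this.le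
    rw [hl] at hfu
    linarith

lemma sInf_neg_aux {m : ℕ} (l : Fin m → ℝ) (A : Set (Fin m → ℝ)) :
    sInf (dot l '' (-A)) = - sSup (dot l '' A) := by
  rw [← Real.sInf_neg]
  congr 1
  ext r
  constructor
  · rintro ⟨a, ha, rfl⟩
    exact ⟨-a, ha, dot_neg_aux l a⟩
  · rintro ⟨a, ha, h⟩
    exact ⟨-a, by simpa using ha, by rw [dot_neg_aux, h, neg_neg]⟩

lemma upper_iff_aux {m : ℕ} {K A B : Set (Fin m → ℝ)} (hcone : IsConeSet K) (h0 : (0 : Fin m → ℝ) ∈ K)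
    (hA : A.Nonempty) (hAc : IsCompact A) (hB : B.Nonempty) (hBc : IsCompact B)
    (hcl : IsClosed (B - K)) (hcv : Convex ℝ (B - K)) :
    upperSetLess K A B ↔ ∀ l ∈ dualCone K \ {0}, sSup (dot l '' A) ≤ sSup (dot l '' B) := by
  have e : -B + K = -(B - K) := by rw [neg_sub', sub_neg_eq_add]
  have key := lower_iff_aux (K := K) (A := -B) (B := -A) hcone h0 hB.neg hBc.neg hA.neg hAc.neg
    (by rw [e]; exact hcl.neg) (by rw [e]; exact hcv.neg)
  have e2 : upperSetLess K A B ↔ lowerSetLess K (-B) (-A) := by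
    constructor
    · intro h a ha
      obtain ⟨b, hb, hab⟩ := h _ ha
      exact ⟨-b, by simpa using hb, by simpa [leK, add_comm, sub_eq_add_neg] using hab⟩
    · intro h a ha
      obtain ⟨b, hb, hab⟩ := h (-a) (by simpa using ha)
      exact ⟨-b, hb, by simpa [leK, add_comm, sub_eq_add_neg] using hab⟩
  rw [e2, key]
  simp only [sInf_neg_aux, neg_le_neg_iff]

/-- Dual-cone characterization of strictly minimal solutions of a set-valued problem:
for a closed, convex, pointed cone `K` and a mapping `S` whose images are nonempty and
compact with `S(x) + K` and `S(x) − K` closed and convex, `x̄ ∈ X` is a strictly minimal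
solution iff for every `x ∈ X`: whenever for all `ℓ ∈ K* \ {0}` one has
`sup_{S(x)} ℓᵀa ≤ sup_{S(x̄)} ℓᵀa` and `inf_{S(x)} ℓᵀa ≤ inf_{S(x̄)} ℓᵀa`, then for all
`ℓ ∈ K* \ {0}` one also has `sup_{S(x̄)} ℓᵀa ≤ sup_{S(x)} ℓᵀa` and
`inf_{S(x̄)} ℓᵀa ≤ inf_{S(x)} ℓᵀa`. -/
theorem strictlyMinimalSolution_iff_dual {n m : ℕ} (K : Set (Fin m → ℝ))
    (X : Set (Fin n → ℝ)) (S : (Fin n → ℝ) → Set (Fin m → ℝ))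
    (hKclosed : IsClosed K) (hKconvex : Convex ℝ K) (hKcone : IsConeSet K)
    (hKpointed : IsPointed K)
    (hS : ∀ x ∈ X, (S x).Nonempty ∧ IsCompact (S x) ∧
      IsClosed (S x + K) ∧ Convex ℝ (S x + K) ∧ IsClosed (S x - K) ∧ Convex ℝ (S x - K))
    (xbar : Fin n → ℝ) (hxbar : xbar ∈ X) :
    StrictlyMinimalSolution X S K xbar ↔
      ∀ x ∈ X,
        (∀ ℓ ∈ dualCone K \ {0},
          sSup (dot ℓ '' S x) ≤ sSup (dot ℓ '' S xbar) ∧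
          sInf (dot ℓ '' S x) ≤ sInf (dot ℓ '' S xbar)) →
        (∀ ℓ ∈ dualCone K \ {0},
          sSup (dot ℓ '' S xbar) ≤ sSup (dot ℓ '' S x) ∧
          sInf (dot ℓ '' S xbar) ≤ sInf (dot ℓ '' S x)) := by
  have h0 : (0 : Fin m → ℝ) ∈ K := by
    have : (0 : Fin m → ℝ) ∈ K ∩ (-K) := by rw [hKpointed]; rfl
    exact this.1
  have key : ∀ x ∈ X, ∀ y ∈ X, (setLess K (S x) (S y) ↔ ∀ ℓ ∈ dualCone K \ {0},
      sSup (dot ℓ '' S x) ≤ sSup (dot ℓ '' S y) ∧ sInf (dot ℓ '' S x) ≤ sInf (dot ℓ '' S y)) := by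
    intro x hx y hy
    obtain ⟨a1, a2, a3, a4, a5, a6⟩ := hS x hx
    obtain ⟨b1, b2, b3, b4, b5, b6⟩ := hS y hy
    rw [setLess, lower_iff_aux hKcone h0 a1 a2 b1 b2 a3 a4,
      upper_iff_aux hKcone h0 a1 a2 b1 b2 b5 b6]
    exact ⟨fun h l hl => ⟨h.2 l hl, h.1 l hl⟩, fun h => ⟨fun l hl => (h l hl).2, fun l hl => (h l hl).1⟩⟩
  constructor
  · rintro ⟨-, h⟩ x hx hle
    exact (key _ hxbar _ hx).1 (h x hx ((key _ hx _ hxbar).2 hle))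
  · intro h
    exact ⟨hxbar, fun x hx hle => (key _ hxbar _ hx).2 (h x hx ((key _ hx _ hxbar).1 hle))⟩
end
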